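/- Let Assumptions (A1) and (A2) hold. There exist positive constants l̃₁, l̃₂, l̃₃, l̃₄ and C₂, such that if the boundary current J_b and δ₀ are sufficiently small, then every solution (p, q, r, V) ∈ H³(0,1) × H²(0,1) × H²(0,1) × H⁵(0,1) of the steady-state perturbation system satisfies l̃₁‖p‖²_{H¹} + l̃₂‖q‖²_{H¹} + l̃₃‖r‖²_{H¹} + l̃₄‖V‖²_{H¹} ≤ C₂ δ₀². -/

import Mathlib

open MeasureTheory Set

noncomputable section

/-- The squared `L²(0,1)` norm of a function. -/
def L2sq (f : ℝ → ℝ) : ℝ := ∫ x in (0:ℝ)..1, (f x) ^ 2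

/-- The squared Sobolev `H^k(0,1)` norm of a function (classical derivatives). -/
def sobSq (k : ℕ) (f : ℝ → ℝ) : ℝ :=
  ∑ i ∈ Finset.range (k + 1), L2sq (iteratedDeriv i f)

/-- `δ₀ = ‖ρ_x‖_{H³(0,1)}`. -/
def delta0 (ρ : ℝ → ℝ) : ℝ := Real.sqrt (sobSq 3 (deriv ρ))

/-- Assumption (A1): `ρ(0) = ρ(1)`, `ρ ∈ C⁴` and `ρ > 0` on `[0,1]`. -/
def AssumpA1 (ρ : ℝ → ℝ) : Prop :=
  ρ 0 = ρ 1 ∧ ContDiff ℝ 4 ρ ∧ ∀ x ∈ Icc (0:ℝ) 1, 0 < ρ x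

/-- Assumption (A2). -/
def AssumpA2 (ν τ lam μ : ℝ) (ρ : ℝ → ℝ) : Prop :=
  ∃ α₀ ∈ Ioo (0:ℝ) 1, ∀ x ∈ Icc (0:ℝ) 1,
    1 / α₀ < Real.sqrt 2 * τ * ν * (2 * μ + 5) * ρ x / (3 * lam ^ 2)

/-- The additional condition (1.6)/(newcond1) of the stability theorem. -/
def NewCond (ν τ lam μ : ℝ) (ρ : ℝ → ℝ) : Prop :=
  ∀ x ∈ Icc (0:ℝ) 1,
    1 < τ * (2 + τ * ν) * (2 * μ + 5) * (μ * ν * lam ^ 2 + ν * ρ x) / (3 * lam ^ 2)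

/-- Membership in `H^k(0,1)` (square-integrability of the classical derivatives). -/
def MemH (k : ℕ) (f : ℝ → ℝ) : Prop :=
  ∀ i ≤ k, IntervalIntegrable (fun x => (iteratedDeriv i f x) ^ 2) volume 0 1

/-- Time derivative of a function of time and space. -/
def tderiv (f : ℝ → ℝ → ℝ) (t x : ℝ) : ℝ := deriv (fun s => f s x) t

/-- Membership in `L²(0,T;H^k(0,1))`. -/
def MemL2H (k : ℕ) (T : ℝ) (f : ℝ → ℝ → ℝ) : Prop :=
  IntervalIntegrable (fun t => sobSq k (f t)) volume 0 T

/-- Membership in `H¹(0,T;H^k(0,1))`. -/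
def MemH1H (k : ℕ) (T : ℝ) (f : ℝ → ℝ → ℝ) : Prop :=
  MemL2H k T f ∧ IntervalIntegrable (fun t => sobSq k (fun x => tderiv f t x)) volume 0 T

/-- Coefficient `a₂` of the steady-state perturbation system. -/
def coefA2 (ν ε τ μ Jb : ℝ) (ρ : ℝ → ℝ) (x : ℝ) : ℝ :=
  -(Jb / τ) - (1 + μ) * deriv ρ x + (2/3) * Jb ^ 2 * deriv ρ x / (ρ x) ^ 2
    + (ε ^ 2 / 18) * (deriv ρ x) ^ 3 / (ρ x) ^ 2

/-- Coefficient `b₂`. -/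
def coefB2 (τ Jb : ℝ) (ρ : ℝ → ℝ) (x : ℝ) : ℝ :=
  1 / τ - (4/3) * Jb * deriv ρ x / (ρ x) ^ 2

/-- Coefficient `c₂`. -/
def coefC2 (ε Jb : ℝ) (ρ : ℝ → ℝ) (x : ℝ) : ℝ :=
  (4/3) * Jb ^ 2 * (deriv ρ x) ^ 2 / (ρ x) ^ 3 - (ε ^ 2 / 9) * (deriv ρ x) ^ 4 / (ρ x) ^ 3

/-- Coefficient `d₂`. -/
def coefD2 (ε μ Jb : ℝ) (ρ : ℝ → ℝ) (x : ℝ) : ℝ :=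
  μ - (2/3) * Jb ^ 2 / (ρ x) ^ 2 - (ε ^ 2 / 6) * (deriv ρ x) ^ 2 / (ρ x) ^ 2

/-- Coefficient `e₂`. -/
def coefE2 (ν ε Jb : ℝ) (ρ : ℝ → ℝ) (x : ℝ) : ℝ :=
  (4/3) * Jb / ρ x - (ε ^ 2 / (9 * ν)) * deriv ρ x / ρ x

/-- Coefficient `a₃`. -/
def coefA3 (ε Jb : ℝ) (ρ : ℝ → ℝ) (x : ℝ) : ℝ :=
  -(2/3) * Jb ^ 3 / (ρ x) ^ 3 + (ε ^ 2 / 9) * Jb * deriv ρ x / (ρ x) ^ 3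

/-- Coefficient `b₃`. -/
def coefB3 (τ Jb : ℝ) (ρ : ℝ → ℝ) (x : ℝ) : ℝ :=
  2 / τ - (5/3) * Jb * deriv ρ x / (ρ x) ^ 2

/-- Coefficient `c₃`. -/
def coefC3 (ε τ Jb : ℝ) (ρ : ℝ → ℝ) (x : ℝ) : ℝ :=
  -(3 / τ) + (5/2) * Jb * (deriv ρ x) ^ 2 / (ρ x) ^ 2 - 2 * Jb ^ 3 * deriv ρ x / (ρ x) ^ 4
    + (ε ^ 2 / 3) * Jb * (deriv ρ x) ^ 4 / (ρ x) ^ 4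

/-- Coefficient `d₃`. -/
def coefD3 (ε Jb : ℝ) (ρ : ℝ → ℝ) (x : ℝ) : ℝ :=
  -(5 * Jb / (2 * ρ x)) - (ε ^ 2 / 3) * Jb * (deriv ρ x) ^ 2 / (ρ x) ^ 3

/-- Coefficient `e₃`. -/
def coefE3 (ν ε μ Jb : ℝ) (ρ : ℝ → ℝ) (x : ℝ) : ℝ :=
  μ + 5/2 - Jb ^ 2 / (ρ x) ^ 2 + (ε ^ 2 / (6 * ν)) * Jb * deriv ρ x / (ρ x) ^ 2
    + (ε ^ 2 / 18) * (deriv ρ x) ^ 2 / (ρ x) ^ 2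

/-- Coefficient `h₃`. -/
def coefH3 (ε Jb : ℝ) (ρ : ℝ → ℝ) (x : ℝ) : ℝ :=
  2 * Jb ^ 2 / (ρ x) ^ 3 - (ε ^ 2 / 9) * (deriv ρ x) ^ 3 / (ρ x) ^ 3

/-- The explicit quadratic remainder `f₂` of the steady-state perturbation system. -/
def f2fun (ν ε Jb : ℝ) (ρ p q V : ℝ → ℝ) (x : ℝ) : ℝ :=
  p x * deriv V x
    - (2/3) * deriv (fun y => (q y + Jb) ^ 2 / (p y + ρ y)) x
    + (ε ^ 2 / 18) * (deriv (fun y => p y + ρ y) x) ^ 3 / (p x + ρ x) ^ 2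
    + (ε ^ 2 / (9 * ν)) * (deriv (fun y => p y + ρ y) x / (p x + ρ x)) * deriv q x
    + (4/3) * (Jb / ρ x) * deriv q x
    - (2/3) * (Jb ^ 2 * deriv ρ x / (ρ x) ^ 2
        - 2 * Jb ^ 2 * (deriv ρ x) ^ 2 / (ρ x) ^ 3 * p x
        + Jb ^ 2 / (ρ x) ^ 2 * deriv p x
        + 2 * Jb * deriv ρ x / (ρ x) ^ 2 * q x)
    - (ε ^ 2 / 18) * (3 * (deriv ρ x) ^ 2 / (ρ x) ^ 2 * deriv p x
        + 2 * (deriv ρ x) ^ 4 / (ρ x) ^ 3 * p x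
        + (deriv ρ x) ^ 3 / (ρ x) ^ 2)
    - (ε ^ 2 / (9 * ν)) * (deriv ρ x / ρ x) * deriv q x

/-- The explicit quadratic remainder `f₃` of the steady-state perturbation system. -/
def f3fun (ν ε Jb : ℝ) (ρ p q r V : ℝ → ℝ) (x : ℝ) : ℝ :=
  q x * deriv V x
    - (5/3) * deriv (fun y => (q y + Jb) / (p y + ρ y) * (r y + (3/2) * ρ y)) x
    + (1/3) * deriv (fun y => (q y + Jb) ^ 3 / (p y + ρ y) ^ 2) x
    + (ε ^ 2 / 18) * deriv (fun y =>
        (q y + Jb) * iteratedDeriv 2 (fun z => p z + ρ z) y / (p y + ρ y)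
          - (q y + Jb) * (deriv (fun z => p z + ρ z) y) ^ 2 / (p y + ρ y) ^ 2) x
    - (ε ^ 2 / (18 * ν)) * (q x + Jb) * iteratedDeriv 2 q x / (p x + ρ x)
    + (5/3) * ((3/2) * Jb * deriv ρ x / ρ x + (3/2) * deriv q x
        + (Jb / ρ x) * deriv r x + (3/2) * (deriv ρ x / ρ x) * q x
        - (3/2) * Jb * (deriv ρ x) ^ 2 / (ρ x) ^ 2 * p x)
    - (5/3) * ((3/2) * Jb * deriv ρ x / ρ x
        - 3 * Jb * (deriv ρ x) ^ 2 / (ρ x) ^ 2 * p x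
        + Jb * deriv ρ x / (ρ x) ^ 2 * r x
        + (3/2) * (deriv ρ x / ρ x) * q x
        + (3/2) * (Jb / ρ x) * deriv p x)
    - (Jb ^ 2 / (ρ x) ^ 2) * deriv q x
    + (2/3) * (Jb ^ 3 / (ρ x) ^ 3 - 3 * Jb ^ 3 * deriv ρ x / (ρ x) ^ 4 * p x
        + 3 * Jb ^ 2 / (ρ x) ^ 3 * q x)
    + (ε ^ 2 / (6 * ν)) * (Jb * deriv ρ x / (ρ x) ^ 2) * deriv q x
    + (ε ^ 2 / 18) * ((deriv ρ x) ^ 2 / (ρ x) ^ 2) * deriv q x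
    - (ε ^ 2 / 9) * (Jb * (deriv ρ x) ^ 3 / (ρ x) ^ 3
        - 3 * Jb * (deriv ρ x) ^ 4 / (ρ x) ^ 4 * p x
        + 3 * Jb * (deriv ρ x) ^ 2 / (ρ x) ^ 3 * deriv p x
        + (deriv ρ x) ^ 3 / (ρ x) ^ 3 * q x)

/-- A (classical) solution of the steady-state perturbation system (2.2). -/
structure IsSteadyPerturbSol (ν ε τ lam μ Jb Vb : ℝ) (ρ p q r V : ℝ → ℝ) : Prop where
  reg_p : ContDiff ℝ 3 p
  reg_q : ContDiff ℝ 2 q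
  reg_r : ContDiff ℝ 2 r
  reg_V : ContDiff ℝ 5 V
  pos : ∀ x ∈ Icc (0:ℝ) 1, 0 < p x + ρ x
  eq1 : ∀ x ∈ Icc (0:ℝ) 1, -ν * iteratedDeriv 2 p x + deriv q x = 0
  eq2 : ∀ x ∈ Icc (0:ℝ) 1,
    -(ν + ε ^ 2 / (18 * ν)) * iteratedDeriv 2 q x + coefB2 τ Jb ρ x * q x
      + coefC2 ε Jb ρ x * p x + coefD2 ε μ Jb ρ x * deriv p x
      + coefE2 ν ε Jb ρ x * deriv q x + (2/3) * deriv r x - ρ x * deriv V x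
      = coefA2 ν ε τ μ Jb ρ x + f2fun ν ε Jb ρ p q V x
  eq3 : ∀ x ∈ Icc (0:ℝ) 1,
    -ν * iteratedDeriv 2 r x + coefB3 τ Jb ρ x * r x + coefC3 ε τ Jb ρ x * p x
      + coefD3 ε Jb ρ x * deriv p x + coefE3 ν ε μ Jb ρ x * deriv q x
      + coefH3 ε Jb ρ x * q x + (5/3) * (Jb / ρ x) * deriv r x - Jb * deriv V x
      = coefA3 ε Jb ρ x + f3fun ν ε Jb ρ p q r V x
        + (ε ^ 2 / (18 * ν)) * iteratedDeriv 2 q x * (q x + Jb) / (p x + ρ x)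
  eq4 : ∀ x ∈ Icc (0:ℝ) 1, -(lam ^ 2) * iteratedDeriv 2 V x + p x = 0
  bc_p : ∀ k : ℕ, k ≤ 3 → iteratedDeriv k p 0 = 0 ∧ iteratedDeriv k p 1 = 0
  bc_q : q 0 = 0 ∧ q 1 = 0
  bc_r : r 0 = 0 ∧ r 1 = 0
  bc_V : deriv V 0 = 0 ∧ deriv V 1 = 0 ∧ V 0 = 0 ∧ V 1 = Vb

/-- The value of the remainder `f₂` in terms of the pointwise values of all functions involved. -/
def f2val (ν ε J R R1 p p1 q q1 w : ℝ) : ℝ :=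
  p * w
    - (2/3) * ((2 * (q + J) * q1 * (p + R) - (q + J) ^ 2 * (p1 + R1)) / (p + R) ^ 2)
    + (ε ^ 2 / 18) * (p1 + R1) ^ 3 / (p + R) ^ 2
    + (ε ^ 2 / (9 * ν)) * ((p1 + R1) / (p + R)) * q1
    + (4/3) * (J / R) * q1
    - (2/3) * (J ^ 2 * R1 / R ^ 2 - 2 * J ^ 2 * R1 ^ 2 / R ^ 3 * p
        + J ^ 2 / R ^ 2 * p1 + 2 * J * R1 / R ^ 2 * q)
    - (ε ^ 2 / 18) * (3 * R1 ^ 2 / R ^ 2 * p1 + 2 * R1 ^ 4 / R ^ 3 * p + R1 ^ 3 / R ^ 2)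
    - (ε ^ 2 / (9 * ν)) * (R1 / R) * q1

/-- The value of `(ν + ε² / (18 ν)) q_{xx}` prescribed by the momentum equation. -/
def momentumVal (ν ε τ μ J R R1 p p1 q q1 r1 w : ℝ) : ℝ :=
  (1 / τ - (4/3) * J * R1 / R ^ 2) * q
    + ((4/3) * J ^ 2 * R1 ^ 2 / R ^ 3 - (ε ^ 2 / 9) * R1 ^ 4 / R ^ 3) * p
    + (μ - (2/3) * J ^ 2 / R ^ 2 - (ε ^ 2 / 6) * R1 ^ 2 / R ^ 2) * p1
    + ((4/3) * J / R - (ε ^ 2 / (9 * ν)) * R1 / R) * q1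
    + (2/3) * r1 - R * w
    - (-(J / τ) - (1 + μ) * R1 + (2/3) * J ^ 2 * R1 / R ^ 2 + (ε ^ 2 / 18) * R1 ^ 3 / R ^ 2)
    - f2val ν ε J R R1 p p1 q q1 w

/-- The value of the remainder `f₃` in terms of the pointwise values of all functions involved. -/
def f3val (ν ε J R R1 R2 R3 p p1 q q1 r r1 w q2 : ℝ) : ℝ :=
  q * w
    - (5/3) * ((q1 * (p + R) - (q + J) * (p1 + R1)) / (p + R) ^ 2 * (r + (3/2) * R)
        + (q + J) / (p + R) * (r1 + (3/2) * R1))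
    + (1/3) * ((3 * (q + J) ^ 2 * q1 * (p + R) ^ 2
        - (q + J) ^ 3 * (2 * (p + R) * (p1 + R1))) / ((p + R) ^ 2) ^ 2)
    + (ε ^ 2 / 18) * (((q1 * (q1 / ν + R2) + (q + J) * (q2 / ν + R3)) * (p + R)
          - (q + J) * (q1 / ν + R2) * (p1 + R1)) / (p + R) ^ 2
        - ((q1 * (p1 + R1) ^ 2 + (q + J) * (2 * (p1 + R1) * (q1 / ν + R2))) * (p + R) ^ 2
          - (q + J) * (p1 + R1) ^ 2 * (2 * (p + R) * (p1 + R1))) / ((p + R) ^ 2) ^ 2)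
    - (ε ^ 2 / (18 * ν)) * (q + J) * q2 / (p + R)
    + (5/3) * ((3/2) * J * R1 / R + (3/2) * q1
        + (J / R) * r1 + (3/2) * (R1 / R) * q
        - (3/2) * J * R1 ^ 2 / R ^ 2 * p)
    - (5/3) * ((3/2) * J * R1 / R
        - 3 * J * R1 ^ 2 / R ^ 2 * p
        + J * R1 / R ^ 2 * r
        + (3/2) * (R1 / R) * q
        + (3/2) * (J / R) * p1)
    - (J ^ 2 / R ^ 2) * q1
    + (2/3) * (J ^ 3 / R ^ 3 - 3 * J ^ 3 * R1 / R ^ 4 * p + 3 * J ^ 2 / R ^ 3 * q)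
    + (ε ^ 2 / (6 * ν)) * (J * R1 / R ^ 2) * q1
    + (ε ^ 2 / 18) * (R1 ^ 2 / R ^ 2) * q1
    - (ε ^ 2 / 9) * (J * R1 ^ 3 / R ^ 3
        - 3 * J * R1 ^ 4 / R ^ 4 * p
        + 3 * J * R1 ^ 2 / R ^ 3 * p1
        + R1 ^ 3 / R ^ 3 * q)

/-- The value of `ν r_{xx}` prescribed by the energy equation. -/
def energyVal (ν ε τ μ J R R1 R2 R3 p p1 q q1 r r1 w q2 : ℝ) : ℝ :=
  (2 / τ - (5/3) * J * R1 / R ^ 2) * r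
    + (-(3 / τ) + (5/2) * J * R1 ^ 2 / R ^ 2 - 2 * J ^ 3 * R1 / R ^ 4
        + (ε ^ 2 / 3) * J * R1 ^ 4 / R ^ 4) * p
    + (-(5 * J / (2 * R)) - (ε ^ 2 / 3) * J * R1 ^ 2 / R ^ 3) * p1
    + (μ + 5/2 - J ^ 2 / R ^ 2 + (ε ^ 2 / (6 * ν)) * J * R1 / R ^ 2
        + (ε ^ 2 / 18) * R1 ^ 2 / R ^ 2) * q1
    + (2 * J ^ 2 / R ^ 3 - (ε ^ 2 / 9) * R1 ^ 3 / R ^ 3) * q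
    + (5/3) * (J / R) * r1 - J * w
    - (-(2/3) * J ^ 3 / R ^ 3 + (ε ^ 2 / 9) * J * R1 / R ^ 3)
    - f3val ν ε J R R1 R2 R3 p p1 q q1 r r1 w q2
    - (ε ^ 2 / (18 * ν)) * q2 * (q + J) / (p + R)

/-- A function differentiable and vanishing at `b` is locally bounded by the distance to `b`. -/
lemma exists_le_mul_of_differentiableAt {E : Type*} [NormedAddCommGroup E] [NormedSpace ℝ E]
    {F : E → ℝ} {b : E} (hF : DifferentiableAt ℝ F b) (h0 : F b = 0) :
    ∃ K > (0:ℝ), ∃ κ > (0:ℝ), ∀ j m, ‖j - b‖ ≤ m → m ≤ κ → |F j| ≤ K * m := by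
  obtain ⟨K, hK, h⟩ := hF.isBigO_sub.exists_pos
  obtain ⟨κ, hκ, hb⟩ := Metric.eventually_nhds_iff.1 h.bound
  refine ⟨K, hK, κ / 2, by positivity, fun j m hj hm => ?_⟩
  have := hb (y := j) (by rw [dist_eq_norm]; linarith)
  simp only [h0, sub_zero, Real.norm_eq_abs] at this
  exact this.trans (by gcongr)

open Asymptotics in
/-- A product of a differentiable and a continuous function, both vanishing at `b`, is `o(x - b)`. -/
lemma isLittleO_mul_of_vanish {E : Type*} [NormedAddCommGroup E] [NormedSpace ℝ E]
    {a D : E → ℝ} {b : E} (ha : DifferentiableAt ℝ a b) (ha0 : a b = 0)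
    (hD : DifferentiableAt ℝ D b) (hD0 : D b = 0) :
    (fun x => a x * D x) =o[nhds b] fun x => x - b := by
  have h1 : a =O[nhds b] fun x => x - b := by simpa [ha0] using ha.isBigO_sub
  have h2 : D =o[nhds b] fun _ => (1:ℝ) :=
    (isLittleO_one_iff ℝ).2 (by simpa [hD0] using hD.continuousAt.tendsto)
  have h3 := (h1.norm_right).mul_isLittleO h2
  simpa using h3

lemma exists_momentumVal_le (ν ε τ μ ρb : ℝ) (hρb : 0 < ρb) :
    ∃ K > (0:ℝ), ∃ κ > (0:ℝ), ∀ m J R R1 p p1 q q1 r1 w : ℝ, 0 ≤ m → m ≤ κ →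
      |J| ≤ m → |R - ρb| ≤ m → |R1| ≤ m → |p| ≤ m → |p1| ≤ m → |q| ≤ m → |q1| ≤ m →
      |r1| ≤ m → |w| ≤ m →
      |momentumVal ν ε τ μ J R R1 p p1 q q1 r1 w| ≤ K * m := by
  obtain ⟨K, hK, κ, hκ, h⟩ := exists_le_mul_of_differentiableAt (b := ![0, ρb, 0, 0, 0, 0, 0, 0, 0])
    (F := fun j : Fin 9 → ℝ =>
      momentumVal ν ε τ μ (j 0) (j 1) (j 2) (j 3) (j 4) (j 5) (j 6) (j 7) (j 8))
    (by
      unfold momentumVal f2val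
      fun_prop (disch := simp <;> positivity))
    (by simp [momentumVal, f2val])
  refine ⟨K, hK, κ, hκ, fun m J R R1 p p1 q q1 r1 w hm hmκ hJ hR hR1 hp hp1 hq hq1 hr1 hw => ?_⟩
  refine h ![J, R, R1, p, p1, q, q1, r1, w] m ?_ hmκ
  rw [pi_norm_le_iff_of_nonneg hm]
  simp [Fin.forall_fin_succ, *]

lemma exists_energyVal_le (ν ε τ μ ρb : ℝ) (hρb : 0 < ρb) :
    ∃ K > (0:ℝ), ∃ κ > (0:ℝ), ∀ m J R R1 R2 R3 p p1 q q1 r r1 w q2 : ℝ, 0 ≤ m → m ≤ κ →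
      |J| ≤ m → |R - ρb| ≤ m → |R1| ≤ m → |R2| ≤ m → |R3| ≤ m → |p| ≤ m → |p1| ≤ m → |q| ≤ m →
      |q1| ≤ m → |r| ≤ m → |r1| ≤ m → |w| ≤ m → |q2| ≤ m →
      |energyVal ν ε τ μ J R R1 R2 R3 p p1 q q1 r r1 w q2| ≤ K * m := by
  obtain ⟨K, hK, κ, hκ, h⟩ := exists_le_mul_of_differentiableAt
    (b := ![0, ρb, 0, 0, 0, 0, 0, 0, 0, 0, 0, 0, 0])
    (F := fun j : Fin 13 → ℝ =>
      energyVal ν ε τ μ (j 0) (j 1) (j 2) (j 3) (j 4) (j 5) (j 6) (j 7) (j 8) (j 9) (j 10) (j 11)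
        (j 12))
    (by
      unfold energyVal f3val
      fun_prop (disch := simp <;> positivity))
    (by simp [energyVal, f3val])
  refine ⟨K, hK, κ, hκ, fun m J R R1 R2 R3 p p1 q q1 r r1 w q2 hm hmκ hJ hR hR1 hR2 hR3 hp hp1 hq
    hq1 hr hr1 hw hq2 => ?_⟩
  refine h ![J, R, R1, R2, R3, p, p1, q, q1, r, r1, w, q2] m ?_ hmκ
  rw [pi_norm_le_iff_of_nonneg hm]
  simp [Fin.forall_fin_succ, *]

open Asymptotics in
/-- The momentum equation is its linearisation up to a small relative error. -/
lemma exists_momentumVal_sub_linear_le (ν ε τ μ ρb : ℝ) (hρb : 0 < ρb) (s : ℝ) (hs : 0 < s) :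
    ∃ κ > (0:ℝ), ∀ m J R R1 p p1 q q1 r1 w : ℝ, 0 ≤ m → m ≤ κ →
      |J| ≤ m → |R - ρb| ≤ m → |R1| ≤ m → |p| ≤ m → |p1| ≤ m → |q| ≤ m → |q1| ≤ m →
      |r1| ≤ m → |w| ≤ m →
      |momentumVal ν ε τ μ J R R1 p p1 q q1 r1 w
        - (J / τ + q / τ + μ * p1 + (2/3) * r1 - ρb * w + (1 + μ) * R1)| ≤ s * m := by
  set b : Fin 9 → ℝ := ![0, ρb, 0, 0, 0, 0, 0, 0, 0] with hb
  set G : (Fin 9 → ℝ) → ℝ := fun j =>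
    momentumVal ν ε τ μ (j 0) (j 1) (j 2) (j 3) (j 4) (j 5) (j 6) (j 7) (j 8)
      - (j 0 / τ + j 5 / τ + μ * j 4 + (2/3) * j 7 - ρb * j 8 + (1 + μ) * j 2) with hG
  have key : G =o[nhds b] fun x => x - b := by
    have h1 : (fun j : Fin 9 → ℝ => j 2 * (-(4/3) * j 0 / j 1 ^ 2 * j 5
        + ((4/3) * j 0 ^ 2 * j 2 / j 1 ^ 3 - (ε ^ 2 / 9) * j 2 ^ 3 / j 1 ^ 3) * j 3
        - (ε ^ 2 / 6) * j 2 / j 1 ^ 2 * j 4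
        - (2/3) * j 0 ^ 2 / j 1 ^ 2 - (ε ^ 2 / 18) * j 2 ^ 2 / j 1 ^ 2
        + (2/3) * (j 0 ^ 2 / j 1 ^ 2 - 2 * j 0 ^ 2 * j 2 / j 1 ^ 3 * j 3
          + 2 * j 0 / j 1 ^ 2 * j 5)
        + (ε ^ 2 / 18) * (3 * j 2 / j 1 ^ 2 * j 4 + 2 * j 2 ^ 3 / j 1 ^ 3 * j 3
          + j 2 ^ 2 / j 1 ^ 2)))
        =o[nhds b] fun x => x - b := by
      apply isLittleO_mul_of_vanish
      · fun_prop
      · simp [hb]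
      · fun_prop (disch := simp [hb] <;> positivity)
      · simp [hb]
    have h2 : (fun j : Fin 9 → ℝ => j 6 * ((4/3) * j 0 / j 1 - (ε ^ 2 / (9 * ν)) * j 2 / j 1
        - (ε ^ 2 / (9 * ν)) * ((j 4 + j 2) / (j 3 + j 1)) - (4/3) * (j 0 / j 1)
        + (ε ^ 2 / (9 * ν)) * (j 2 / j 1)))
        =o[nhds b] fun x => x - b := by
      apply isLittleO_mul_of_vanish
      · fun_prop
      · simp [hb]
      · fun_prop (disch := simp [hb] <;> positivity)
      · simp [hb]
    have h3 : (fun j : Fin 9 → ℝ => j 8 * (ρb - j 1 - j 3)) =o[nhds b] fun x => x - b := by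
      apply isLittleO_mul_of_vanish
      · fun_prop
      · simp [hb]
      · fun_prop
      · simp [hb]
    have h4 : (fun j : Fin 9 → ℝ => j 0 * (-(2/3) * j 0 / j 1 ^ 2 * j 4
        + (2/3) * (j 0 / j 1 ^ 2 * j 4)))
        =o[nhds b] fun x => x - b := by
      apply isLittleO_mul_of_vanish
      · fun_prop
      · simp [hb]
      · fun_prop (disch := simp [hb] <;> positivity)
      · simp [hb]
    have h5 : (fun j : Fin 9 → ℝ => (j 5 + j 0) * ((2/3) * ((2 * j 6 * (j 3 + j 1)
        - (j 5 + j 0) * (j 4 + j 2)) / (j 3 + j 1) ^ 2)))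
        =o[nhds b] fun x => x - b := by
      apply isLittleO_mul_of_vanish
      · fun_prop
      · simp [hb]
      · fun_prop (disch := simp [hb] <;> positivity)
      · simp [hb]
    have h6 : (fun j : Fin 9 → ℝ => (j 4 + j 2) * (-(ε ^ 2 / 18) * (j 4 + j 2) ^ 2
        / (j 3 + j 1) ^ 2))
        =o[nhds b] fun x => x - b := by
      apply isLittleO_mul_of_vanish
      · fun_prop
      · simp [hb]
      · fun_prop (disch := simp [hb] <;> positivity)
      · simp [hb]
    refine (((((h1.add h2).add h3).add h4).add h5).add h6).congr_left fun j => ?_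
    simp only [hG, momentumVal, f2val]
    ring
  obtain ⟨κ, hκ, h⟩ := Metric.eventually_nhds_iff.1 (key.def hs)
  refine ⟨κ / 2, by positivity, fun m J R R1 p p1 q q1 r1 w hm hmκ hJ hR hR1 hp hp1 hq hq1 hr1 hw =>
    ?_⟩
  have hn : ‖![J, R, R1, p, p1, q, q1, r1, w] - b‖ ≤ m := by
    rw [pi_norm_le_iff_of_nonneg hm]
    simp [Fin.forall_fin_succ, *]
  exact (h (y := ![J, R, R1, p, p1, q, q1, r1, w]) (by rw [dist_eq_norm]; linarith)).trans
    (by gcongr)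

lemma hasDerivAt_iteratedDeriv {f : ℝ → ℝ} {n : ℕ} (hf : ContDiff ℝ n f) (k : ℕ) (hk : k < n)
    (x : ℝ) : HasDerivAt (iteratedDeriv k f) (iteratedDeriv (k + 1) f x) x := by
  rw [iteratedDeriv_succ]
  exact ((hf.differentiable_iteratedDeriv k (by exact_mod_cast hk)) x).hasDerivAt

lemma hasDerivAt_zeroth {f : ℝ → ℝ} {n : ℕ} (hf : ContDiff ℝ n f) (hk : 0 < n) (x : ℝ) :
    HasDerivAt f (deriv f x) x := by
  simpa using hasDerivAt_iteratedDeriv hf 0 hk x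

lemma hasDerivAt_first {f : ℝ → ℝ} {n : ℕ} (hf : ContDiff ℝ n f) (hk : 1 < n) (x : ℝ) :
    HasDerivAt (deriv f) (iteratedDeriv 2 f x) x := by
  simpa using hasDerivAt_iteratedDeriv hf 1 hk x

/-- Pointwise Sobolev embedding `H¹(0,1) ⊆ L^∞(0,1)` for `C¹` functions. -/
lemma sq_le_L2sq_add {g : ℝ → ℝ} (hg : ContDiff ℝ 1 g) {x : ℝ} (hx : x ∈ Icc (0:ℝ) 1) :
    g x ^ 2 ≤ 2 * L2sq g + L2sq (deriv g) := by
  have hc : Continuous g := hg.continuous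
  have hc' : Continuous (deriv g) := hg.continuous_deriv (by norm_num)
  have hd : ∀ y, HasDerivAt g (deriv g y) y := fun y =>
    (hg.differentiable (by norm_num) y).hasDerivAt
  have hi : ∀ a b, IntervalIntegrable (fun y => g y ^ 2 + deriv g y ^ 2) volume a b := fun a b =>
    (Continuous.intervalIntegrable (by fun_prop) _ _)
  have hsum : ∫ y in (0:ℝ)..1, (g y ^ 2 + deriv g y ^ 2) = L2sq g + L2sq (deriv g) :=
    intervalIntegral.integral_add (Continuous.intervalIntegrable (by fun_prop) _ _)
      (Continuous.intervalIntegrable (by fun_prop) _ _)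
  have hpt : ∀ y ∈ Icc (0:ℝ) 1, g x ^ 2 ≤ g y ^ 2 + (L2sq g + L2sq (deriv g)) := by
    intro y hy
    have hftc : ∫ z in y..x, 2 * g z * deriv g z = g x ^ 2 - g y ^ 2 := by
      refine intervalIntegral.integral_eq_sub_of_hasDerivAt (f := fun z => g z ^ 2)
        (fun z _ => ?_) (Continuous.intervalIntegrable (by fun_prop) _ _)
      simpa using (hd z).fun_pow 2
    have hle : |∫ z in y..x, 2 * g z * deriv g z| ≤
        |∫ z in y..x, (g z ^ 2 + deriv g z ^ 2)| := by
      refine intervalIntegral.norm_integral_le_abs_of_norm_le (f := fun z => 2 * g z * deriv g z)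
        (Filter.Eventually.of_forall fun z => ?_) (hi _ _)
      rw [Real.norm_eq_abs, abs_le]
      constructor <;> nlinarith [sq_nonneg (g z + deriv g z), sq_nonneg (g z - deriv g z)]
    have hmono : |∫ z in y..x, (g z ^ 2 + deriv g z ^ 2)| ≤
        ∫ z in (0:ℝ)..1, (g z ^ 2 + deriv g z ^ 2) := by
      rw [← abs_of_nonneg (a := ∫ z in (0:ℝ)..1, (g z ^ 2 + deriv g z ^ 2))
        (intervalIntegral.integral_nonneg (by norm_num) fun z _ => by positivity)]
      refine intervalIntegral.abs_integral_mono_interval ?_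
        (Filter.Eventually.of_forall fun z => by positivity) (hi _ _)
      rw [uIoc_of_le zero_le_one, uIoc]
      exact Ioc_subset_Ioc (le_min hy.1 hx.1) (max_le hy.2 hx.2)
    have := (le_abs_self _).trans (hle.trans hmono)
    rw [hftc, hsum] at this
    linarith
  have := intervalIntegral.integral_mono_on (a := (0:ℝ)) (b := 1) zero_le_one
    (Continuous.intervalIntegrable (by fun_prop) _ _)
    (Continuous.intervalIntegrable (by fun_prop) _ _) hpt (μ := volume)
  rw [intervalIntegral.integral_add (Continuous.intervalIntegrable (by fun_prop) _ _)
    (Continuous.intervalIntegrable (by fun_prop) _ _)] at this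
  simp only [intervalIntegral.integral_const, sub_zero, one_smul] at this
  change _ ≤ L2sq g + _ at this
  linarith

lemma L2sq_nonneg (f : ℝ → ℝ) : 0 ≤ L2sq f :=
  intervalIntegral.integral_nonneg zero_le_one fun _ _ => sq_nonneg _

lemma sobSq_nonneg (k : ℕ) (f : ℝ → ℝ) : 0 ≤ sobSq k f :=
  Finset.sum_nonneg fun _ _ => L2sq_nonneg _

lemma delta0_nonneg (ρ : ℝ → ℝ) : 0 ≤ delta0 ρ := Real.sqrt_nonneg _

lemma abs_iteratedDeriv_le_delta0 {ρ : ℝ → ℝ} (hρ : ContDiff ℝ 4 ρ) (k : ℕ) (hk : k < 3)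
    {x : ℝ} (hx : x ∈ Icc (0:ℝ) 1) : |iteratedDeriv (k + 1) ρ x| ≤ 2 * delta0 ρ := by
  have hsq : delta0 ρ ^ 2 = sobSq 3 (deriv ρ) := Real.sq_sqrt (sobSq_nonneg _ _)
  have hsum : sobSq 3 (deriv ρ) = L2sq (iteratedDeriv 1 ρ) + L2sq (iteratedDeriv 2 ρ)
      + L2sq (iteratedDeriv 3 ρ) + L2sq (iteratedDeriv 4 ρ) := by
    simp only [sobSq, Finset.sum_range_succ, Finset.sum_range_zero, ← iteratedDeriv_succ', zero_add]
  have hreg : ContDiff ℝ 1 (iteratedDeriv (k + 1) ρ) :=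
    by
      rw [iteratedDeriv_eq_iterate]
      exact ContDiff.iterate_deriv' 1 (k + 1)
        (hρ.of_le (by exact_mod_cast (by lia : 1 + (k + 1) ≤ 4)))
  have h := sq_le_L2sq_add hreg hx
  rw [← iteratedDeriv_succ] at h
  refine abs_le_of_sq_le_sq ?_ (by linarith [delta0_nonneg ρ])
  have h1 := L2sq_nonneg (iteratedDeriv 1 ρ)
  have h2 := L2sq_nonneg (iteratedDeriv 2 ρ)
  have h3 := L2sq_nonneg (iteratedDeriv 3 ρ)
  have h4 := L2sq_nonneg (iteratedDeriv 4 ρ)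
  interval_cases k <;> simp only [zero_add, Nat.reduceAdd] at h ⊢ <;> nlinarith

/-- A bound on the derivative controls the variation on `[0,1]`. -/
lemma abs_sub_zero_le_of_deriv {f f' : ℝ → ℝ} {C : ℝ}
    (hf : ∀ x ∈ Icc (0:ℝ) 1, HasDerivAt f (f' x) x) (hC : ∀ x ∈ Icc (0:ℝ) 1, |f' x| ≤ C)
    {x : ℝ} (hx : x ∈ Icc (0:ℝ) 1) : |f x - f 0| ≤ C := by
  have := (convex_Icc (0:ℝ) 1).norm_image_sub_le_of_norm_hasDerivWithin_le
    (fun x hx => (hf x hx).hasDerivWithinAt) hC (left_mem_Icc.2 zero_le_one) hx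
  have h0 : 0 ≤ C := (abs_nonneg _).trans (hC x hx)
  refine this.trans ?_
  rw [sub_zero, Real.norm_eq_abs, abs_of_nonneg hx.1]
  nlinarith [hx.2]

lemma abs_sub_le_delta0 {ρ : ℝ → ℝ} (hρ : ContDiff ℝ 4 ρ) {x : ℝ} (hx : x ∈ Icc (0:ℝ) 1) :
    |ρ x - ρ 0| ≤ 2 * delta0 ρ := by
  refine abs_sub_zero_le_of_deriv (f' := deriv ρ)
    (fun x _ => hasDerivAt_zeroth (n := 4) (by exact_mod_cast hρ) (by norm_num) x)
    (fun y hy => ?_) hx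
  simpa using abs_iteratedDeriv_le_delta0 hρ 0 (by norm_num) hy

lemma sobSq_one_le {f : ℝ → ℝ} {B : ℝ} (hf : ContDiff ℝ 1 f)
    (h0 : ∀ x ∈ Icc (0:ℝ) 1, |f x| ≤ B) (h1 : ∀ x ∈ Icc (0:ℝ) 1, |deriv f x| ≤ B) :
    sobSq 1 f ≤ 2 * B ^ 2 := by
  have hL : ∀ g : ℝ → ℝ, Continuous g → (∀ x ∈ Icc (0:ℝ) 1, |g x| ≤ B) → L2sq g ≤ B ^ 2 := by
    intro g hg hB
    have := intervalIntegral.integral_mono_on (a := (0:ℝ)) (b := 1) zero_le_one (μ := volume)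
      (f := fun x => g x ^ 2) (g := fun _ => B ^ 2)
      (Continuous.intervalIntegrable (by fun_prop) _ _)
      (Continuous.intervalIntegrable (by fun_prop) _ _)
      (fun x hx => sq_le_sq' (abs_le.1 (hB x hx)).1 (abs_le.1 (hB x hx)).2)
    simpa [L2sq] using this
  have e : sobSq 1 f = L2sq f + L2sq (deriv f) := by
    simp [sobSq, Finset.sum_range_succ]
  rw [e]
  linarith [hL f hf.continuous h0, hL _ (hf.continuous_deriv (by norm_num)) h1]

section Solution

variable {ν ε τ lam μ Jb Vb : ℝ} {ρ p q r V : ℝ → ℝ}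

lemma IsSteadyPerturbSol.iteratedDeriv_two_p (hν : 0 < ν)
    (h : IsSteadyPerturbSol ν ε τ lam μ Jb Vb ρ p q r V) {x : ℝ} (hx : x ∈ Icc (0:ℝ) 1) :
    iteratedDeriv 2 p x = deriv q x / ν := by
  have := h.eq1 x hx
  field_simp
  linarith

lemma IsSteadyPerturbSol.iteratedDeriv_three_p (hν : 0 < ν)
    (h : IsSteadyPerturbSol ν ε τ lam μ Jb Vb ρ p q r V) {x : ℝ} (hx : x ∈ Icc (0:ℝ) 1) :
    iteratedDeriv 3 p x = iteratedDeriv 2 q x / ν := by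
  have h1 : HasDerivAt (iteratedDeriv 2 p) (iteratedDeriv 3 p x) x :=
    hasDerivAt_iteratedDeriv (n := 3) (by exact_mod_cast h.reg_p) 2 (by norm_num) x
  have h2 : HasDerivAt (fun y => deriv q y / ν) (iteratedDeriv 2 q x / ν) x :=
    (hasDerivAt_first (n := 2) (by exact_mod_cast h.reg_q) (by norm_num) x).div_const ν
  exact (uniqueDiffOn_Icc zero_lt_one x hx).eq_deriv _ h1.hasDerivWithinAt
    (h2.hasDerivWithinAt.congr (fun y hy => h.iteratedDeriv_two_p hν hy)
      (h.iteratedDeriv_two_p hν hx))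

lemma IsSteadyPerturbSol.momentum (hρ : ContDiff ℝ 4 ρ)
    (h : IsSteadyPerturbSol ν ε τ lam μ Jb Vb ρ p q r V) {x : ℝ} (hx : x ∈ Icc (0:ℝ) 1) :
    (ν + ε ^ 2 / (18 * ν)) * iteratedDeriv 2 q x =
      momentumVal ν ε τ μ Jb (ρ x) (deriv ρ x) (p x) (deriv p x) (q x) (deriv q x) (deriv r x)
        (deriv V x) := by
  have hdp := hasDerivAt_zeroth (n := 3) (by exact_mod_cast h.reg_p) (by norm_num) x
  have hdq := hasDerivAt_zeroth (n := 2) (by exact_mod_cast h.reg_q) (by norm_num) x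
  have hdρ := hasDerivAt_zeroth (n := 4) (by exact_mod_cast hρ) (by norm_num) x
  have hn := hdp.add hdρ
  have hne : p x + ρ x ≠ 0 := (h.pos x hx).ne'
  have e1 : deriv (fun y => p y + ρ y) x = deriv p x + deriv ρ x := hn.deriv
  have e2 : deriv (fun y => (q y + Jb) ^ 2 / (p y + ρ y)) x =
      (2 * (q x + Jb) * deriv q x * (p x + ρ x) - (q x + Jb) ^ 2 * (deriv p x + deriv ρ x))
        / (p x + ρ x) ^ 2 := by
    have := (((hdq.add_const Jb).pow 2).div hn hne).deriv
    refine Eq.trans this ?_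
    simp
  have := h.eq2 x hx
  simp only [coefA2, coefB2, coefC2, coefD2, coefE2, f2fun, e1, e2] at this
  simp only [momentumVal, f2val]
  linarith

lemma IsSteadyPerturbSol.energy (hν : 0 < ν) (hρ : ContDiff ℝ 4 ρ)
    (h : IsSteadyPerturbSol ν ε τ lam μ Jb Vb ρ p q r V) {x : ℝ} (hx : x ∈ Icc (0:ℝ) 1) :
    ν * iteratedDeriv 2 r x =
      energyVal ν ε τ μ Jb (ρ x) (deriv ρ x) (iteratedDeriv 2 ρ x) (iteratedDeriv 3 ρ x)
        (p x) (deriv p x) (q x) (deriv q x) (r x) (deriv r x) (deriv V x)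
        (iteratedDeriv 2 q x) := by
  have hp3 : ContDiff ℝ (3:ℕ) p := by exact_mod_cast h.reg_p
  have hq2 : ContDiff ℝ (2:ℕ) q := by exact_mod_cast h.reg_q
  have hr2 : ContDiff ℝ (2:ℕ) r := by exact_mod_cast h.reg_r
  have hρ4 : ContDiff ℝ (4:ℕ) ρ := by exact_mod_cast hρ
  have hdp := fun y => hasDerivAt_zeroth hp3 (by norm_num) y
  have hdq := hasDerivAt_zeroth hq2 (by norm_num) x
  have hdr := hasDerivAt_zeroth hr2 (by norm_num) x
  have hdρ := fun y => hasDerivAt_zeroth hρ4 (by norm_num) y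
  have hn := (hdp x).add (hdρ x)
  have hne : p x + ρ x ≠ 0 := (h.pos x hx).ne'
  have e1 : deriv (fun y => p y + ρ y) = fun y => deriv p y + deriv ρ y :=
    funext fun y => ((hdp y).add (hdρ y)).deriv
  have e2 : iteratedDeriv 2 (fun y => p y + ρ y) =
      fun y => iteratedDeriv 2 p y + iteratedDeriv 2 ρ y := by
    rw [iteratedDeriv_succ, iteratedDeriv_one, e1]
    exact funext fun y => ((hasDerivAt_first hp3 (by norm_num) y).add
      (hasDerivAt_first hρ4 (by norm_num) y)).deriv
  have hn1 := (hasDerivAt_first hp3 (by norm_num) x).add (hasDerivAt_first hρ4 (by norm_num) x)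
  have hn2 := (hasDerivAt_iteratedDeriv hp3 2 (by norm_num) x).add
    (hasDerivAt_iteratedDeriv hρ4 2 (by norm_num) x)
  have hJ := hdq.add_const Jb
  have e3 : deriv (fun y => (q y + Jb) / (p y + ρ y) * (r y + (3/2) * ρ y)) x =
      (deriv q x * (p x + ρ x) - (q x + Jb) * (deriv p x + deriv ρ x)) / (p x + ρ x) ^ 2
          * (r x + (3/2) * ρ x)
        + (q x + Jb) / (p x + ρ x) * (deriv r x + (3/2) * deriv ρ x) :=
    ((hJ.div hn hne).mul (hdr.add ((hdρ x).const_mul (3/2)))).deriv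
  have e4 : deriv (fun y => (q y + Jb) ^ 3 / (p y + ρ y) ^ 2) x =
      (3 * (q x + Jb) ^ 2 * deriv q x * (p x + ρ x) ^ 2
        - (q x + Jb) ^ 3 * (2 * (p x + ρ x) * (deriv p x + deriv ρ x)))
        / ((p x + ρ x) ^ 2) ^ 2 := by
    refine Eq.trans ((hJ.pow 3).div (hn.pow 2) (pow_ne_zero 2 hne)).deriv ?_
    simp
  have e5 : deriv (fun y =>
        (q y + Jb) * (iteratedDeriv 2 p y + iteratedDeriv 2 ρ y) / (p y + ρ y)
          - (q y + Jb) * (deriv p y + deriv ρ y) ^ 2 / (p y + ρ y) ^ 2) x =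
      ((deriv q x * (iteratedDeriv 2 p x + iteratedDeriv 2 ρ x)
            + (q x + Jb) * (iteratedDeriv 3 p x + iteratedDeriv 3 ρ x)) * (p x + ρ x)
          - (q x + Jb) * (iteratedDeriv 2 p x + iteratedDeriv 2 ρ x) * (deriv p x + deriv ρ x))
          / (p x + ρ x) ^ 2
        - ((deriv q x * (deriv p x + deriv ρ x) ^ 2
            + (q x + Jb) * (2 * (deriv p x + deriv ρ x)
              * (iteratedDeriv 2 p x + iteratedDeriv 2 ρ x))) * (p x + ρ x) ^ 2
          - (q x + Jb) * (deriv p x + deriv ρ x) ^ 2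
            * (2 * (p x + ρ x) * (deriv p x + deriv ρ x))) / ((p x + ρ x) ^ 2) ^ 2 := by
    refine Eq.trans (((hJ.mul hn2).div hn hne).sub
      ((hJ.mul (hn1.pow 2)).div (hn.pow 2) (pow_ne_zero 2 hne))).deriv ?_
    simp
  have := h.eq3 x hx
  simp only [coefA3, coefB3, coefC3, coefD3, coefE3, coefH3, f3fun, e2] at this
  simp only [e1, e3, e4, e5, h.iteratedDeriv_two_p hν hx,
    h.iteratedDeriv_three_p hν hx] at this
  simp only [energyVal, f3val]
  linarith

lemma IsSteadyPerturbSol.q_eq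
    (h : IsSteadyPerturbSol ν ε τ lam μ Jb Vb ρ p q r V) {x : ℝ} (hx : x ∈ Icc (0:ℝ) 1) :
    q x = ν * deriv p x := by
  have h1 := abs_sub_zero_le_of_deriv (C := 0) (f := fun y => q y - ν * deriv p y)
    (f' := fun y => deriv q y - ν * iteratedDeriv 2 p y)
    (fun y _ => (hasDerivAt_zeroth (n := 2) (by exact_mod_cast h.reg_q) (by norm_num) y).sub
      ((hasDerivAt_first (n := 3) (by exact_mod_cast h.reg_p) (by norm_num) y).const_mul ν))
    (fun y hy => by
      have := h.eq1 y hy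
      rw [show deriv q y - ν * iteratedDeriv 2 p y = 0 by linarith, abs_zero]) hx
  have h2 := (h.bc_p 1 (by norm_num)).1
  rw [iteratedDeriv_one] at h2
  simp only [h.bc_q.1, h2, mul_zero, sub_zero] at h1
  linarith [abs_nonpos_iff.1 h1]

end Solution

set_option maxHeartbeats 800000 in
/-- The overdetermined boundary conditions at `0` make the system an initial value problem whose
solution stays small on `[0,1]`. -/
lemma exists_jet_bound (ν ε τ lam μ Vb ρb : ℝ) (hν : 0 < ν) (hlam : 0 < lam) (hρb : 0 < ρb) :
    ∃ M ≥ (1:ℝ), ∃ D0 > (0:ℝ), ∀ (ρ : ℝ → ℝ) (Jb : ℝ) (p q r V : ℝ → ℝ) (D : ℝ),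
      ContDiff ℝ 4 ρ → 0 < D → D ≤ D0 → |Jb| ≤ D →
      (∀ x ∈ Icc (0:ℝ) 1, |ρ x - ρb| ≤ D) → (∀ x ∈ Icc (0:ℝ) 1, |deriv ρ x| ≤ D) →
      (∀ x ∈ Icc (0:ℝ) 1, |iteratedDeriv 2 ρ x| ≤ D) →
      (∀ x ∈ Icc (0:ℝ) 1, |iteratedDeriv 3 ρ x| ≤ D) →
      IsSteadyPerturbSol ν ε τ lam μ Jb Vb ρ p q r V →
      ∀ x ∈ Icc (0:ℝ) 1, |deriv V x| ≤ M * D ∧ |p x| ≤ M * D ∧ |deriv p x| ≤ M * D ∧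
        |q x| ≤ M * D ∧ |deriv q x| ≤ M * D ∧ |r x| ≤ M * D ∧ |deriv r x| ≤ M * D := by
  obtain ⟨K2, hK2, κ2, hκ2, hmom⟩ := exists_momentumVal_le ν ε τ μ ρb hρb
  obtain ⟨K3, hK3, κ3, hκ3, hen⟩ := exists_energyVal_le ν ε τ μ ρb hρb
  set c : ℝ := ν + ε ^ 2 / (18 * ν) with hc
  have hc0 : 0 < c := by positivity
  set Q : ℝ := K2 / c + 1 with hQ
  have hQ1 : 1 ≤ Q := by rw [hQ]; linarith [div_pos hK2 hc0]
  have hQ0 : 0 < Q := by linarith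
  set L : ℝ := 2 * (1 / lam ^ 2 + 1 + 1 / ν + 1 + Q + 1 + K3 * Q / ν) + 1 with hL
  have hL0 : 0 < L := by positivity
  set A : ℝ := 1 + ((3/2) * K2) ^ 2 with hA
  have hA1 : 1 ≤ A := by rw [hA]; linarith [sq_nonneg ((3/2) * K2)]
  set M : ℝ := Real.sqrt (A * Real.exp L) with hM
  have hM2 : M ^ 2 = A * Real.exp L := Real.sq_sqrt (by positivity)
  have hM1 : 1 ≤ M := by
    rw [hM, Real.one_le_sqrt]
    nlinarith [Real.one_le_exp hL0.le]
  have hM0 : 0 < M := by linarith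
  refine ⟨M, hM1, min κ2 (κ3 / Q) / M, by positivity, ?_⟩
  intro ρ Jb p q r V D hρ hD hDD hJ hR hR1 hR2 hR3 h
  rw [le_div_iff₀ hM0, le_min_iff, le_div_iff₀ hQ0] at hDD
  obtain ⟨hDκ2, hDκ3⟩ := hDD
  have hp3 : ContDiff ℝ (3:ℕ) p := by exact_mod_cast h.reg_p
  have hq2 : ContDiff ℝ (2:ℕ) q := by exact_mod_cast h.reg_q
  have hr2 : ContDiff ℝ (2:ℕ) r := by exact_mod_cast h.reg_r
  have hV5 : ContDiff ℝ (5:ℕ) V := by exact_mod_cast h.reg_V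
  have dw := fun x => hasDerivAt_first hV5 (by norm_num) x
  have dp := fun x => hasDerivAt_zeroth hp3 (by norm_num) x
  have dp1 := fun x => hasDerivAt_first hp3 (by norm_num) x
  have dq := fun x => hasDerivAt_zeroth hq2 (by norm_num) x
  have dq1 := fun x => hasDerivAt_first hq2 (by norm_num) x
  have dr := fun x => hasDerivAt_zeroth hr2 (by norm_num) x
  have dr1 := fun x => hasDerivAt_first hr2 (by norm_num) x
  set N : ℝ → ℝ := fun x => deriv V x ^ 2 + p x ^ 2 + deriv p x ^ 2 + q x ^ 2 + deriv q x ^ 2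
    + r x ^ 2 + deriv r x ^ 2 with hN
  set N' : ℝ → ℝ := fun x => 2 * deriv V x * iteratedDeriv 2 V x + 2 * p x * deriv p x
    + 2 * deriv p x * iteratedDeriv 2 p x + 2 * q x * deriv q x
    + 2 * deriv q x * iteratedDeriv 2 q x + 2 * r x * deriv r x
    + 2 * deriv r x * iteratedDeriv 2 r x with hN'
  have dN : ∀ x, HasDerivAt N (N' x) x := by
    intro x
    have := (((((((dw x).fun_pow 2).fun_add ((dp x).fun_pow 2)).fun_add
      ((dp1 x).fun_pow 2)).fun_add ((dq x).fun_pow 2)).fun_add ((dq1 x).fun_pow 2)).fun_add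
      ((dr x).fun_pow 2)).fun_add ((dr1 x).fun_pow 2)
    simpa using this
  have hle : ∀ {x m : ℝ}, 0 ≤ m → N x ≤ m ^ 2 → |deriv V x| ≤ m ∧ |p x| ≤ m ∧ |deriv p x| ≤ m ∧
      |q x| ≤ m ∧ |deriv q x| ≤ m ∧ |r x| ≤ m ∧ |deriv r x| ≤ m := by
    intro x m hm hNm
    simp only [hN] at hNm
    have h1 := sq_nonneg (deriv V x)
    have h2 := sq_nonneg (p x)
    have h3 := sq_nonneg (deriv p x)
    have h4 := sq_nonneg (q x)
    have h5 := sq_nonneg (deriv q x)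
    have h6 := sq_nonneg (r x)
    have h7 := sq_nonneg (deriv r x)
    refine ⟨?_, ?_, ?_, ?_, ?_, ?_, ?_⟩ <;> exact abs_le_of_sq_le_sq (by linarith) hm
  set B : ℝ → ℝ := fun x => A * D ^ 2 * Real.exp (L * x) with hB
  have dB : ∀ x, HasDerivAt B (L * B x) x := by
    intro x
    have := (((hasDerivAt_id x).const_mul L).exp).const_mul (A * D ^ 2)
    refine this.congr_deriv ?_
    simp only [hB, id]
    ring
  have hB1 : ∀ x ∈ Icc (0:ℝ) 1, B x ≤ (M * D) ^ 2 := by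
    intro x hx
    have : Real.exp (L * x) ≤ Real.exp L := Real.exp_le_exp.2 (by nlinarith [hx.2])
    rw [mul_pow, hM2]
    simp only [hB]
    calc A * D ^ 2 * Real.exp (L * x) ≤ A * D ^ 2 * Real.exp L := by gcongr
      _ = _ := by ring
  have hB0 : ∀ x ∈ Icc (0:ℝ) 1, D ^ 2 ≤ B x := by
    intro x hx
    have : 1 ≤ Real.exp (L * x) := Real.one_le_exp (by have := hx.1; positivity)
    have h1 : 1 ≤ A * Real.exp (L * x) := by nlinarith
    simp only [hB]
    nlinarith [sq_nonneg D]
  have hDM : D ≤ M * D := by nlinarith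
  have h0mem : (0:ℝ) ∈ Icc (0:ℝ) 1 := left_mem_Icc.2 zero_le_one
  have hinit : N 0 ≤ B 0 := by
    have p0 : p 0 = 0 := by simpa using (h.bc_p 0 (by norm_num)).1
    have p1 : deriv p 0 = 0 := by simpa using (h.bc_p 1 (by norm_num)).1
    have p2 : iteratedDeriv 2 p 0 = 0 := (h.bc_p 2 (by norm_num)).1
    have p3 : iteratedDeriv 3 p 0 = 0 := (h.bc_p 3 (by norm_num)).1
    have q1 : deriv q 0 = 0 := by
      have := h.eq1 0 h0mem
      rw [p2] at this
      linarith
    have q2 : iteratedDeriv 2 q 0 = 0 := by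
      have := h.iteratedDeriv_three_p hν h0mem
      rw [p3, eq_comm, div_eq_zero_iff] at this
      exact this.resolve_right hν.ne'
    have e := h.momentum hρ h0mem
    rw [q2, p0, p1, q1, h.bc_q.1, h.bc_V.1, mul_zero] at e
    have e' : momentumVal ν ε τ μ Jb (ρ 0) (deriv ρ 0) 0 0 0 0 0 0 = -((2/3) * deriv r 0) := by
      have : momentumVal ν ε τ μ Jb (ρ 0) (deriv ρ 0) 0 0 0 0 (deriv r 0) 0 =
          momentumVal ν ε τ μ Jb (ρ 0) (deriv ρ 0) 0 0 0 0 0 0 + (2/3) * deriv r 0 := by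
        simp only [momentumVal]
        ring
      linarith
    have hb := hmom D Jb (ρ 0) (deriv ρ 0) 0 0 0 0 0 0 hD.le (hDM.trans (by linarith)) hJ
      (hR 0 h0mem) (hR1 0 h0mem) (by simpa using hD.le) (by simpa using hD.le)
      (by simpa using hD.le) (by simpa using hD.le) (by simpa using hD.le) (by simpa using hD.le)
    rw [e', abs_neg, abs_mul, abs_of_pos (by norm_num : (0:ℝ) < 2/3)] at hb
    have hb' : deriv r 0 ^ 2 ≤ ((3/2) * K2 * D) ^ 2 :=
      sq_le_sq.2 ((by linarith : |deriv r 0| ≤ (3/2) * K2 * D).trans (le_abs_self _))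
    simp only [hN, hB, p0, p1, q1, h.bc_q.1, h.bc_V.1, h.bc_r.1, mul_zero, Real.exp_zero, hA]
    nlinarith [sq_nonneg D]
  have hbound : ∀ x ∈ Ico (0:ℝ) 1, N x = B x → N' x < L * B x := by
    intro x hx' hNB
    have hx : x ∈ Icc (0:ℝ) 1 := ⟨hx'.1, hx'.2.le⟩
    have hBpos : 0 < B x := by simp only [hB]; positivity
    set m : ℝ := Real.sqrt (B x) with hm
    have hm0 : 0 ≤ m := Real.sqrt_nonneg _
    have hm2 : m ^ 2 = B x := Real.sq_sqrt hBpos.le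
    have hDm : D ≤ m := Real.le_sqrt_of_sq_le (hB0 x hx)
    have hmM : m ≤ M * D := Real.sqrt_le_iff.2 ⟨by positivity, hB1 x hx⟩
    obtain ⟨hw, hp, hp1, hq, hq1, hr, hr1⟩ := hle hm0 (hNB.trans hm2.symm).le
    have hq2 : |iteratedDeriv 2 q x| ≤ Q * m := by
      have hb := hmom m Jb (ρ x) (deriv ρ x) (p x) (deriv p x) (q x) (deriv q x) (deriv r x)
        (deriv V x) hm0 (hmM.trans (by linarith)) (hJ.trans hDm) ((hR x hx).trans hDm)
        ((hR1 x hx).trans hDm) hp hp1 hq hq1 hr1 hw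
      rw [← h.momentum hρ hx, abs_mul, abs_of_pos hc0, ← le_div_iff₀' hc0] at hb
      refine hb.trans ?_
      rw [hQ, add_mul, one_mul, mul_div_right_comm]
      linarith
    have hmQ : m ≤ Q * m := by nlinarith
    have hr2 : |iteratedDeriv 2 r x| ≤ K3 * Q / ν * m := by
      have hb := hen (Q * m) Jb (ρ x) (deriv ρ x) (iteratedDeriv 2 ρ x) (iteratedDeriv 3 ρ x) (p x)
        (deriv p x) (q x) (deriv q x) (r x) (deriv r x) (deriv V x) (iteratedDeriv 2 q x)
        (by positivity) (by nlinarith) (hJ.trans (by linarith))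
        ((hR x hx).trans (by linarith)) ((hR1 x hx).trans (by linarith))
        ((hR2 x hx).trans (by linarith)) ((hR3 x hx).trans (by linarith)) (hp.trans hmQ)
        (hp1.trans hmQ) (hq.trans hmQ) (hq1.trans hmQ) (hr.trans hmQ) (hr1.trans hmQ)
        (hw.trans hmQ) hq2
      rw [← h.energy hν hρ hx, abs_mul, abs_of_pos hν, ← le_div_iff₀' hν] at hb
      refine hb.trans_eq ?_
      ring
    have hV2 : |iteratedDeriv 2 V x| ≤ 1 / lam ^ 2 * m := by
      have e : iteratedDeriv 2 V x = 1 / lam ^ 2 * p x := by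
        have := h.eq4 x hx
        field_simp
        linarith
      rw [e, abs_mul, abs_of_pos (by positivity)]
      gcongr
    have hp2 : |iteratedDeriv 2 p x| ≤ 1 / ν * m := by
      rw [h.iteratedDeriv_two_p hν hx, abs_div, abs_of_pos hν, div_eq_mul_one_div, mul_comm]
      gcongr
    have hprod : ∀ {a b k : ℝ}, |a| ≤ m → |b| ≤ k * m → 2 * a * b ≤ 2 * k * m ^ 2 := by
      intro a b k ha hb
      calc 2 * a * b ≤ |2 * a * b| := le_abs_self _
        _ = 2 * (|a| * |b|) := by rw [abs_mul, abs_mul, abs_two]; ring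
        _ ≤ 2 * (m * (k * m)) := by gcongr
        _ = _ := by ring
    have t1 := hprod hw hV2
    have t2 := hprod (k := 1) hp (by simpa using hp1)
    have t3 := hprod hp1 hp2
    have t4 := hprod (k := 1) hq (by simpa using hq1)
    have t5 := hprod hq1 hq2
    have t6 := hprod (k := 1) hr (by simpa using hr1)
    have t7 := hprod hr1 hr2
    have hm2pos : 0 < m ^ 2 := by rw [hm2]; exact hBpos
    have hsum := add_le_add (add_le_add (add_le_add (add_le_add (add_le_add (add_le_add t1 t2) t3)
      t4) t5) t6) t7
    rw [← hm2]
    refine lt_of_le_of_lt hsum ?_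
    rw [hL]
    linarith only [hm2pos]
  intro x hx
  refine hle (by positivity) (le_trans ?_ (hB1 x hx))
  exact image_le_of_deriv_right_lt_deriv_boundary'
    (fun x _ => (dN x).continuousAt.continuousWithinAt)
    (fun x _ => (dN x).hasDerivWithinAt) hinit
    (fun x _ => (dB x).continuousAt.continuousWithinAt)
    (fun x _ => (dB x).hasDerivWithinAt) hbound hx

/-- estimate (2.12): first-order a-priori estimate for solutions of the
steady-state perturbation system, for `J_b` and `δ₀` sufficiently small. -/
theorem steady_perturbation_H1_estimate
    (ν ε τ lam μ Vb ρb : ℝ) (hν : 0 < ν) (hε : 0 < ε) (hτ : 0 < τ)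
    (hlam : 0 < lam) (hμ : 0 < μ) (hρb : 0 < ρb) :
    ∃ l1 > (0:ℝ), ∃ l2 > (0:ℝ), ∃ l3 > (0:ℝ), ∃ l4 > (0:ℝ), ∃ C2 > (0:ℝ), ∃ η > (0:ℝ),
      ∀ (ρ : ℝ → ℝ) (Jb : ℝ) (p q r V : ℝ → ℝ),
        AssumpA1 ρ → ρ 0 = ρb → AssumpA2 ν τ lam μ ρ →
        |Jb| ≤ η → delta0 ρ ≤ η →
        IsSteadyPerturbSol ν ε τ lam μ Jb Vb ρ p q r V →
        l1 * sobSq 1 p + l2 * sobSq 1 q + l3 * sobSq 1 r + l4 * sobSq 1 V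
          ≤ C2 * (delta0 ρ) ^ 2 := by
  obtain ⟨M, hM1, D0, hD0, hjet⟩ := exists_jet_bound ν ε τ lam μ Vb ρb hν hlam hρb
  have hM0 : 0 < M := by linarith
  obtain ⟨κ, hκ, hlin⟩ := exists_momentumVal_sub_linear_le ν ε τ μ ρb hρb (1 / (2 * τ * M))
    (by positivity)
  obtain ⟨D1, hD1, hD1V⟩ : ∃ D1 > (0:ℝ), Vb ≠ 0 → M * D1 < |Vb| := by
    by_cases hVb : Vb = 0
    · exact ⟨1, one_pos, fun h => absurd hVb h⟩
    · have := abs_pos.2 hVb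
      refine ⟨|Vb| / (2 * M), by positivity, fun _ => ?_⟩
      rw [show M * (|Vb| / (2 * M)) = |Vb| / 2 by field_simp]
      linarith
  set D2 : ℝ := min (min D0 D1) (κ / M) with hD2
  have hD2pos : 0 < D2 := by positivity
  refine ⟨1, one_pos, 1, one_pos, 1, one_pos, 1, one_pos, 8 * M ^ 2 * 16, by positivity, D2 / 4,
    by positivity, ?_⟩
  intro ρ Jb p q r V hA1 hρ0 _ hJη hδη h
  obtain ⟨hρ01, hρ, -⟩ := hA1
  have hδ := delta0_nonneg ρ
  -- the bound for every `D` slightly larger than `|J_b| + 2 δ₀`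
  have main : ∀ t > 0, t ≤ D2 / 4 → sobSq 1 p + sobSq 1 q + sobSq 1 r + sobSq 1 V ≤
      8 * (M * (4 * delta0 ρ + 2 * t)) ^ 2 := by
    intro t ht htD
    set D : ℝ := |Jb| + 2 * delta0 ρ + t with hD
    have hJ0 := abs_nonneg Jb
    have hDpos : 0 < D := by positivity
    have hDD2 : D ≤ D2 := by linarith
    have hDD0 : D ≤ D0 := hDD2.trans ((min_le_left _ _).trans (min_le_left _ _))
    have hDD1 : D ≤ D1 := hDD2.trans ((min_le_left _ _).trans (min_le_right _ _))
    have hDκ : M * D ≤ κ := by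
      rw [mul_comm, ← le_div_iff₀ hM0]
      exact hDD2.trans (min_le_right _ _)
    have hR : ∀ x ∈ Icc (0:ℝ) 1, |ρ x - ρb| ≤ D := fun x hx => by
      have := abs_sub_le_delta0 hρ hx
      rw [hρ0] at this
      linarith
    have hRk : ∀ k < 3, ∀ x ∈ Icc (0:ℝ) 1, |iteratedDeriv (k + 1) ρ x| ≤ D := fun k hk x hx => by
      have := abs_iteratedDeriv_le_delta0 hρ k hk hx
      linarith
    have hR1 : ∀ x ∈ Icc (0:ℝ) 1, |deriv ρ x| ≤ D := by simpa using hRk 0 (by norm_num)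
    have hb := hjet ρ Jb p q r V D hρ hDpos hDD0 (by linarith) hR hR1
      (hRk 1 (by norm_num)) (hRk 2 (by norm_num)) h
    have hDM : D ≤ M * D := by nlinarith
    have h1mem : (1:ℝ) ∈ Icc (0:ℝ) 1 := right_mem_Icc.2 zero_le_one
    have h0mem : (0:ℝ) ∈ Icc (0:ℝ) 1 := left_mem_Icc.2 zero_le_one
    have dV := fun x => hasDerivAt_zeroth (n := 5) (f := V) (by exact_mod_cast h.reg_V)
      (by norm_num) x
    have hV : ∀ x ∈ Icc (0:ℝ) 1, |V x| ≤ M * D := fun x hx => by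
      have := abs_sub_zero_le_of_deriv (fun y _ => dV y) (fun y hy => (hb y hy).1) hx
      rwa [h.bc_V.2.2.1, sub_zero] at this
    have hVb : Vb = 0 := by
      by_contra hne
      have h1 := hV 1 h1mem
      rw [h.bc_V.2.2.2] at h1
      have h2 : M * D ≤ M * D1 := by gcongr
      linarith [hD1V hne]
    -- integrating the momentum equation over `[0,1]` controls `J_b` by `δ₀`
    have hflux : |Jb| / τ ≤ 1 / (2 * τ * M) * (M * D) := by
      have dΦ : ∀ x ∈ Icc (0:ℝ) 1, HasDerivAt (fun y => (ν + ε ^ 2 / (18 * ν)) * deriv q y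
          - (Jb / τ * y + ν / τ * p y + μ * p y + (2/3) * r y - ρb * V y + (1 + μ) * ρ y))
          (momentumVal ν ε τ μ Jb (ρ x) (deriv ρ x) (p x) (deriv p x) (q x) (deriv q x)
            (deriv r x) (deriv V x)
          - (Jb / τ + q x / τ + μ * deriv p x + (2/3) * deriv r x - ρb * deriv V x
            + (1 + μ) * deriv ρ x)) x := by
        intro x hx
        have dp := hasDerivAt_zeroth (n := 3) (f := p) (by exact_mod_cast h.reg_p) (by norm_num) x
        have dr := hasDerivAt_zeroth (n := 2) (f := r) (by exact_mod_cast h.reg_r) (by norm_num) x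
        have dρ := hasDerivAt_zeroth (n := 4) (f := ρ) (by exact_mod_cast hρ) (by norm_num) x
        have dq1 := hasDerivAt_first (n := 2) (f := q) (by exact_mod_cast h.reg_q) (by norm_num) x
        have := (dq1.const_mul (ν + ε ^ 2 / (18 * ν))).fun_sub
          (((((((hasDerivAt_id' x).const_mul (Jb / τ)).fun_add (dp.const_mul (ν / τ))).fun_add
            (dp.const_mul μ)).fun_add (dr.const_mul (2/3))).fun_sub ((dV x).const_mul ρb)).fun_add
            (dρ.const_mul (1 + μ)))
        refine this.congr_deriv ?_
        rw [h.momentum hρ hx, h.q_eq hx]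
        ring
      have := abs_sub_zero_le_of_deriv dΦ (fun x hx => by
        obtain ⟨hw, hp, hp1, hq, hq1, -, hr1⟩ := hb x hx
        exact hlin (M * D) Jb (ρ x) (deriv ρ x) (p x) (deriv p x) (q x) (deriv q x) (deriv r x)
          (deriv V x) (by positivity) hDκ (by linarith) ((hR x hx).trans hDM)
          ((hR1 x hx).trans hDM) hp hp1 hq hq1 hr1 hw) h1mem
      have p0 := h.bc_p 0 (by norm_num)
      have p2 := h.bc_p 2 (by norm_num)
      rw [iteratedDeriv_zero] at p0
      have q0 := h.eq1 0 h0mem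
      have q1 := h.eq1 1 h1mem
      rw [p2.1, mul_zero, zero_add] at q0
      rw [p2.2, mul_zero, zero_add] at q1
      simp only [p0.1, p0.2, q0, q1, h.bc_r.1, h.bc_r.2, h.bc_V.2.2.1, h.bc_V.2.2.2, hVb, hρ01]
        at this
      rw [show |Jb| / τ = |-(Jb / τ)| by rw [abs_neg, abs_div, abs_of_pos hτ]]
      refine le_trans (le_of_eq (congrArg _ ?_)) this
      ring
    have hJ : |Jb| ≤ 2 * delta0 ρ + t := by
      rw [show 1 / (2 * τ * M) * (M * D) = D / 2 / τ by field_simp,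
        div_le_div_iff_of_pos_right hτ] at hflux
      linarith
    have hDle : M * D ≤ M * (4 * delta0 ρ + 2 * t) := by
      gcongr
      linarith
    have hsq : (M * D) ^ 2 ≤ (M * (4 * delta0 ρ + 2 * t)) ^ 2 := by gcongr
    have sp := sobSq_one_le (f := p) (h.reg_p.of_le (by norm_num)) (fun x hx => (hb x hx).2.1)
      (fun x hx => (hb x hx).2.2.1)
    have sq := sobSq_one_le (f := q) (h.reg_q.of_le (by norm_num))
      (fun x hx => (hb x hx).2.2.2.1) (fun x hx => (hb x hx).2.2.2.2.1)
    have sr := sobSq_one_le (f := r) (h.reg_r.of_le (by norm_num))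
      (fun x hx => (hb x hx).2.2.2.2.2.1) (fun x hx => (hb x hx).2.2.2.2.2.2)
    have sV := sobSq_one_le (f := V) (h.reg_V.of_le (by norm_num)) hV
      (fun x hx => (hb x hx).1)
    linarith
  have hlim : Filter.Tendsto (fun t : ℝ => 8 * (M * (4 * delta0 ρ + 2 * t)) ^ 2)
      (nhdsWithin 0 (Ioi 0)) (nhds (8 * (M * (4 * delta0 ρ + 2 * 0)) ^ 2)) :=
    ((by fun_prop : Continuous fun t : ℝ => 8 * (M * (4 * delta0 ρ + 2 * t)) ^ 2).tendsto
      0).mono_left nhdsWithin_le_nhds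
  have := ge_of_tendsto hlim (Filter.mem_of_superset
    (Ioc_mem_nhdsGT (by positivity : (0:ℝ) < D2 / 4)) fun t ht => main t ht.1 ht.2)
  calc _ = sobSq 1 p + sobSq 1 q + sobSq 1 r + sobSq 1 V := by ring
    _ ≤ _ := this
    _ = _ := by ring
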